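/- Let (R, 𝔪, k) be a Gorenstein Noetherian local ring. Let 𝔠₁ and 𝔠₂ be ideals of the same height g such that R/𝔠₁ and R/𝔠₂ are Gorenstein local rings, and let M₁, M, M₂ be finitely generated R-modules such that M₁ is linked to M by 𝔠₁ and M is linked to M₂ by 𝔠₂ (so M₁ and M₂ are evenly linked). If M₁ is sequentially Cohen-Macaulay as an R-module, then M₂ is sequentially Cohen-Macaulay as an R-module. -/

import Mathlib

open CategoryTheory Opposite IsLocalRing

/-- The Ext module `Ext^i_R(M, N)` as an object of `ModuleCat R`. -/
noncomputable def extMod (R : Type) [CommRing R] (M N : Type) [AddCommGroup M] [Module R M]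
    [AddCommGroup N] [Module R N] (i : ℕ) : ModuleCat R :=
  ((Ext R (ModuleCat R) i).obj (op (ModuleCat.of R M))).obj (ModuleCat.of R N)

/-- The Tor module `Tor_i^R(M, N)` as an object of `ModuleCat R`. -/
noncomputable def torMod (R : Type) [CommRing R] (M N : Type) [AddCommGroup M] [Module R M]
    [AddCommGroup N] [Module R N] (i : ℕ) : ModuleCat R :=
  ((Tor (ModuleCat R) i).obj (ModuleCat.of R M)).obj (ModuleCat.of R N)

/-- The depth of a module over a Noetherian local ring: the least `i` such that
`Ext^i_R(k, M) ≠ 0`, with the convention `depth 0 = ⊤` (as `sInf ∅ = ⊤` in `ℕ∞`). -/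
noncomputable def rdepth (R : Type) [CommRing R] [IsLocalRing R] (M : Type) [AddCommGroup M]
    [Module R M] : ℕ∞ :=
  sInf {n : ℕ∞ | ∃ i : ℕ, Nontrivial (extMod R (ResidueField R) M i) ∧ n = i}

/-- The Krull dimension of a module: `dim R⧸Ann M`. -/
noncomputable def mdim (R : Type) [CommRing R] (M : Type) [AddCommGroup M] [Module R M] :
    WithBot ℕ∞ :=
  ringKrullDim (R ⧸ Module.annihilator R M)

/-- `M` is Cohen-Macaulay of dimension `n`: depth and dimension both equal `n`. -/
def isCMofDim (R : Type) [CommRing R] [IsLocalRing R] (M : Type) [AddCommGroup M] [Module R M]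
    (n : ℕ) : Prop :=
  rdepth R M = (n : ℕ∞) ∧ mdim R M = (n : ℕ)

/-- `M` is Cohen-Macaulay: depth equals dimension. -/
def isCM (R : Type) [CommRing R] [IsLocalRing R] (M : Type) [AddCommGroup M] [Module R M] : Prop :=
  (rdepth R M : WithBot ℕ∞) = mdim R M

/-- `R` is a Cohen-Macaulay local ring of dimension `d`. -/
def isCMLocalRing (R : Type) [CommRing R] [IsLocalRing R] (d : ℕ) : Prop :=
  ringKrullDim R = (d : ℕ) ∧ rdepth R R = (d : ℕ∞)

/-- `M` has Sliding Depth of Extension modules: for `1 ≤ i ≤ d-1`, either `Ext^i(M,R) = 0`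
or `depth Ext^i(M,R) ≥ d - i`. -/
def isSDE (R : Type) [CommRing R] [IsLocalRing R] (M : Type) [AddCommGroup M] [Module R M]
    (d : ℕ) : Prop :=
  ∀ i : ℕ, 1 ≤ i → i ≤ d - 1 →
    Subsingleton (extMod R M R i) ∨ ((d - i : ℕ) : ℕ∞) ≤ rdepth R (extMod R M R i)

/-- `M` has Cohen-Macaulay Extension modules: for `1 ≤ i ≤ d-1`, either `Ext^i(M,R) = 0`
or `Ext^i(M,R)` is Cohen-Macaulay of dimension `d - i`. -/
def isCME (R : Type) [CommRing R] [IsLocalRing R] (M : Type) [AddCommGroup M] [Module R M]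
    (d : ℕ) : Prop :=
  ∀ i : ℕ, 1 ≤ i → i ≤ d - 1 →
    Subsingleton (extMod R M R i) ∨ isCMofDim R (extMod R M R i) (d - i)

/-- `M` is sequentially Cohen-Macaulay: it has a filtration with Cohen-Macaulay quotients
of strictly increasing dimensions. -/
def isSeqCM (R : Type) [CommRing R] [IsLocalRing R] (M : Type) [AddCommGroup M] [Module R M] :
    Prop :=
  ∃ (r : ℕ) (Φ : Fin (r + 1) → Submodule R M), Φ 0 = ⊥ ∧ Φ (Fin.last r) = ⊤ ∧ StrictMono Φ ∧
    (∀ i : Fin r, isCM R (↥(Φ i.succ) ⧸ (Φ i.castSucc).comap (Φ i.succ).subtype)) ∧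
    (∀ i j : Fin r, i < j →
      mdim R (↥(Φ i.succ) ⧸ (Φ i.castSucc).comap (Φ i.succ).subtype) <
      mdim R (↥(Φ j.succ) ⧸ (Φ j.castSucc).comap (Φ j.succ).subtype))

/-- `ω` is a canonical module of the `d`-dimensional local ring `R`:
`Ext^i_R(k, ω) = 0` for `i ≠ d` and `Ext^d_R(k, ω) ≅ k`. -/
def isCanonicalModule (R : Type) [CommRing R] [IsLocalRing R] (d : ℕ) (ω : Type)
    [AddCommGroup ω] [Module R ω] : Prop :=
  Module.Finite R ω ∧ (∀ i : ℕ, i ≠ d → Subsingleton (extMod R (ResidueField R) ω i)) ∧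
    Nonempty ((extMod R (ResidueField R) ω d) ≃ₗ[R] ResidueField R)

/-- The local cohomology module `H^i_𝔪(M)` supported at the maximal ideal. -/
noncomputable def lcMod (R : Type) [CommRing R] [IsLocalRing R] (i : ℕ) (M : Type)
    [AddCommGroup M] [Module R M] : ModuleCat R :=
  (localCohomology (maximalIdeal R) i).obj (ModuleCat.of R M)

/-- The 𝔪-torsion submodule `Γ_𝔪(M) = {x ∈ M | 𝔪^n x = 0 for some n}`. -/
noncomputable def mTorsion (R : Type) [CommRing R] [IsLocalRing R] (M : Type) [AddCommGroup M]
    [Module R M] : Submodule R M :=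
  ⨆ n : ℕ, Submodule.torsionBySet R M ((maximalIdeal R ^ n : Ideal R) : Set R)

/-- The natural evaluation (biduality) map `M → Hom_R(Hom_R(M, ω), ω)`. -/
noncomputable def evMap (R : Type) [CommRing R] (M ω : Type) [AddCommGroup M] [Module R M]
    [AddCommGroup ω] [Module R ω] : M →ₗ[R] ((M →ₗ[R] ω) →ₗ[R] ω) :=
  (LinearMap.id : (M →ₗ[R] ω) →ₗ[R] (M →ₗ[R] ω)).flip

/-- Serre's condition `(S₂)` on the punctured spectrum. -/
def serreS2Punctured (R : Type) [CommRing R] [IsLocalRing R] (M : Type) [AddCommGroup M]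
    [Module R M] : Prop :=
  ∀ (𝔭 : Ideal R) [𝔭.IsPrime], 𝔭 ≠ maximalIdeal R →
    min (2 : WithBot ℕ∞) (mdim (Localization.AtPrime 𝔭) (LocalizedModule 𝔭.primeCompl M)) ≤
      (rdepth (Localization.AtPrime 𝔭) (LocalizedModule 𝔭.primeCompl M) : WithBot ℕ∞)

/-- Two finitely generated `S`-modules `M` and `N` are horizontally linked: `M ≅ λ_S N` and
`N ≅ λ_S M`, where `λ_S N = image(f* : Hom(F₀,S) → Hom(F₁,S))` for a finite free presentation
`F₁ →f F₀ → N → 0`. -/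
def horizontallyLinked (S : Type) [CommRing S] (M N : Type) [AddCommGroup M] [Module S M]
    [AddCommGroup N] [Module S N] : Prop :=
  (∃ (n₀ n₁ : ℕ) (f : (Fin n₁ → S) →ₗ[S] (Fin n₀ → S)) (g : (Fin n₀ → S) →ₗ[S] N),
      Function.Surjective g ∧ LinearMap.range f = LinearMap.ker g ∧
      Nonempty (M ≃ₗ[S] ↥(LinearMap.range f.dualMap))) ∧
  (∃ (n₀ n₁ : ℕ) (f : (Fin n₁ → S) →ₗ[S] (Fin n₀ → S)) (g : (Fin n₀ → S) →ₗ[S] M),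
      Function.Surjective g ∧ LinearMap.range f = LinearMap.ker g ∧
      Nonempty (N ≃ₗ[S] ↥(LinearMap.range f.dualMap)))

/-- `M` is linked to `N` by the ideal `𝔠`: `𝔠` annihilates both modules and they are
horizontally linked as `R ⧸ 𝔠`-modules. -/
def linkedByIdeal (R : Type) [CommRing R] (𝔠 : Ideal R) (M N : Type) [AddCommGroup M]
    [Module R M] [AddCommGroup N] [Module R N] : Prop :=
  ∃ (h₁ : Module.IsTorsionBySet R M (𝔠 : Set R)) (h₂ : Module.IsTorsionBySet R N (𝔠 : Set R)),
    @horizontallyLinked (R ⧸ 𝔠) _ M N _ h₁.module _ h₂.module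

/-- The height of an ideal: the infimum of the heights of primes containing it. -/
noncomputable def idealHeight (R : Type) [CommRing R] (I : Ideal R) : ℕ∞ :=
  ⨅ (𝔭 : PrimeSpectrum R) (_ : I ≤ 𝔭.asIdeal), Order.height 𝔭

/-- A Noetherian local ring is Gorenstein if `Ext^i_S(k,S) = 0` for `i ≠ dim S` and
`Ext^{dim S}_S(k, S) ≅ k`, i.e. `S` is a canonical module of itself. -/
def isGorensteinLocalRing (S : Type) [CommRing S] [IsLocalRing S] : Prop :=
  ∃ e : ℕ, ringKrullDim S = (e : ℕ) ∧ isCanonicalModule S e S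

section ExtVanishing

variable {R : Type} [CommRing R]

/-- The module `Ext^i_R(A, B)`, computed in the derived category, vanishes. -/
def ExtVanishes (R : Type) [CommRing R] (A B : Type) [AddCommGroup A] [Module R A]
    [AddCommGroup B] [Module R B] (i : ℕ) : Prop :=
  Subsingleton (Abelian.Ext.{0} (ModuleCat.of R A) (ModuleCat.of R B) i)

variable {A B C N L : Type} [AddCommGroup A] [Module R A] [AddCommGroup B] [Module R B]
  [AddCommGroup C] [Module R C] [AddCommGroup N] [Module R N] [AddCommGroup L] [Module R L]

theorem shortExact_of_linearMap {f : A →ₗ[R] B} {g : B →ₗ[R] C} (hf : Function.Injective f)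
    (hg : Function.Surjective g) (hfg : Function.Exact f g) :
    (ModuleCat.shortComplexOfCompEqZero f g hfg.linearMap_comp_eq_zero).ShortExact where
  exact := ModuleCat.shortComplex_exact _ hfg
  mono_f := (ModuleCat.mono_iff_injective _).2 hf
  epi_g := (ModuleCat.epi_iff_surjective _).2 hg

theorem subsingleton_extMod_iff (i : ℕ) :
    Subsingleton (extMod R A B i) ↔ ExtVanishes R A B i := by
  let P := projectiveResolution (ModuleCat.of R A)
  have e := P.isoExt (R := R) i (ModuleCat.of R B)
  have h1 : Subsingleton (extMod R A B i) ↔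
      ((P.complex.linearYonedaObj R (ModuleCat.of R B)).ExactAt i) := by
    rw [HomologicalComplex.exactAt_iff_isZero_homology, ← e.isZero_iff,
      ModuleCat.isZero_iff_subsingleton]
    rfl
  rw [h1]
  cases i with
  | zero =>
    rw [HomologicalComplex.exactAt_iff' _ 0 0 1 (by simp) (by simp),
      ShortComplex.moduleCat_exact_iff, ExtVanishes, Abelian.Ext.addEquiv₀.subsingleton_congr]
    constructor
    · intro h
      refine subsingleton_of_forall_eq 0 fun f => ?_
      let π : P.complex.X 0 ⟶ ModuleCat.of R A := P.π.f 0
      have hπ : P.complex.d 1 0 ≫ π = 0 := P.complex_d_comp_π_f_zero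
      have : Epi π := inferInstanceAs (Epi (P.π.f 0))
      obtain ⟨g, hg⟩ := h (π ≫ f) (by
        change P.complex.d 1 0 ≫ π ≫ f = 0
        rw [reassoc_of% hπ, Limits.zero_comp])
      change P.complex.X 0 ⟶ ModuleCat.of R B at g
      change P.complex.d 0 0 ≫ g = π ≫ f at hg
      rw [P.complex.shape 0 0 (by simp), Limits.zero_comp] at hg
      exact (Limits.zero_of_epi_comp π hg.symm)
    · intro h f hf
      refine ⟨0, ?_⟩
      rw [map_zero]
      change P.complex.X 0 ⟶ ModuleCat.of R B at f
      change P.complex.d 1 0 ≫ f = 0 at hf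
      have : Epi (ShortComplex.mk _ _ P.complex_d_comp_π_f_zero).g :=
        inferInstanceAs (Epi (P.π.f 0))
      rw [← P.exact₀.g_desc f hf]
      let g : ModuleCat.of R A ⟶ ModuleCat.of R B := P.exact₀.desc f hf
      have hg : P.exact₀.desc f hf = 0 := @Subsingleton.elim _ h g 0
      rw [hg, Limits.comp_zero]
      rfl
  | succ n =>
    rw [HomologicalComplex.exactAt_iff' _ n (n+1) (n+2) (by simp) (by simp),
      ShortComplex.moduleCat_exact_iff]
    constructor
    · intro h
      refine subsingleton_of_forall_eq 0 fun α => ?_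
      obtain ⟨f, hf, rfl⟩ := P.extMk_surjective α (n + 2) rfl
      rw [P.extMk_eq_zero_iff _ _ _ _ n rfl]
      exact h f hf
    · intro h f hf
      exact (P.extMk_eq_zero_iff f (n + 2) rfl hf n rfl).1
        (@Subsingleton.elim _ h _ _)

theorem ExtVanishes.congr {A' B' : Type} [AddCommGroup A'] [Module R A'] [AddCommGroup B']
    [Module R B'] (e : A ≃ₗ[R] A') (e' : B ≃ₗ[R] B') {i : ℕ} (h : ExtVanishes R A B i) :
    ExtVanishes R A' B' i := by
  refine subsingleton_of_forall_eq 0 fun x => ?_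
  obtain ⟨E⟩ : Nonempty (ModuleCat.of R A ≅ ModuleCat.of R A') := ⟨e.toModuleIso⟩
  obtain ⟨E'⟩ : Nonempty (ModuleCat.of R B ≅ ModuleCat.of R B') := ⟨e'.toModuleIso⟩
  have := @Subsingleton.elim _ h
    ((Abelian.Ext.mk₀ E.hom).comp (x.comp (Abelian.Ext.mk₀ E'.inv) (add_zero _)) (zero_add _)) 0
  have h2 := congrArg (fun y => (Abelian.Ext.mk₀ E.inv).comp
    (y.comp (Abelian.Ext.mk₀ E'.hom) (add_zero _)) (zero_add _)) this
  simpa using h2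

theorem extVanishes_zero_iff : ExtVanishes R A B 0 ↔ Subsingleton (A →ₗ[R] B) :=
  (Abelian.Ext.addEquiv₀.trans ModuleCat.homAddEquiv).subsingleton_congr

theorem ExtVanishes.of_exact_contravariant {f : A →ₗ[R] B} {g : B →ₗ[R] C}
    (hf : Function.Injective f) (hg : Function.Surjective g) (hfg : Function.Exact f g) {i : ℕ}
    (hA : ExtVanishes R A N i) (hC : ExtVanishes R C N i) : ExtVanishes R B N i := by
  refine subsingleton_of_forall_eq 0 fun x => ?_
  obtain ⟨y, rfl⟩ := Abelian.Ext.contravariant_sequence_exact₂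
    (shortExact_of_linearMap hf hg hfg) _ x (@Subsingleton.elim _ hA _ _)
  rw [@Subsingleton.elim _ hC y 0]
  simp

theorem ExtVanishes.left_of_exact {f : A →ₗ[R] B} {g : B →ₗ[R] C}
    (hf : Function.Injective f) (hg : Function.Surjective g) (hfg : Function.Exact f g) {i : ℕ}
    (hB : ExtVanishes R B N i) (hC : ExtVanishes R C N (i + 1)) : ExtVanishes R A N i := by
  refine subsingleton_of_forall_eq 0 fun x => ?_
  obtain ⟨y, rfl⟩ := Abelian.Ext.contravariant_sequence_exact₁
    (shortExact_of_linearMap hf hg hfg) _ x (add_comm 1 i) (@Subsingleton.elim _ hC _ _)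
  rw [@Subsingleton.elim _ hB y 0]
  simp

theorem ExtVanishes.covariant_left_of_exact {f : A →ₗ[R] B} {g : B →ₗ[R] C}
    (hf : Function.Injective f) (hg : Function.Surjective g) (hfg : Function.Exact f g) {i : ℕ}
    (hC : ExtVanishes R L C i) (hB : ExtVanishes R L B (i + 1)) : ExtVanishes R L A (i + 1) := by
  refine subsingleton_of_forall_eq 0 fun x => ?_
  obtain ⟨y, rfl⟩ := Abelian.Ext.covariant_sequence_exact₁ _
    (shortExact_of_linearMap hf hg hfg) x (@Subsingleton.elim _ hB _ _) rfl
  rw [@Subsingleton.elim _ hC y 0]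
  simp

theorem ExtVanishes.pi_fin {i : ℕ} (h : ExtVanishes R L N i) (n : ℕ) :
    ExtVanishes R L (Fin n → N) i := by
  refine subsingleton_of_forall_eq 0 fun x => ?_
  have hid : 𝟙 (ModuleCat.of R (Fin n → N)) = ∑ j : Fin n,
      ModuleCat.ofHom (LinearMap.proj j : (Fin n → N) →ₗ[R] N) ≫
        ModuleCat.ofHom (LinearMap.single R (fun _ => N) j) := by
    ext v j
    simp [ModuleCat.hom_sum, Finset.sum_apply, Pi.single_apply]
  have hx := x.comp_mk₀_id
  rw [hid, Abelian.Ext.mk₀_sum, Abelian.Ext.comp_sum] at hx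
  rw [← hx]
  refine Finset.sum_eq_zero fun j _ => ?_
  rw [← Abelian.Ext.mk₀_comp_mk₀, ← Abelian.Ext.comp_assoc_of_second_deg_zero]
  rw [@Subsingleton.elim _ h (x.comp _ _) 0, Abelian.Ext.zero_comp]

theorem ExtVanishes.of_isSMulRegular [IsNoetherianRing R] [IsLocalRing R] [Module.Finite R A]
    [Module.Finite R N] {x : R} (hx : x ∈ maximalIdeal R) (hreg : IsSMulRegular A x) {i : ℕ}
    (h : ExtVanishes R (QuotSMulTop x A) N (i + 1)) : ExtVanishes R A N i := by
  have hex := hreg.smulShortComplex_shortExact (M := ModuleCat.of R A)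
  have key (y : Abelian.Ext.{0} (ModuleCat.of R A) (ModuleCat.of R N) i) : ∃ z, x • z = y := by
    obtain ⟨z, rfl⟩ := Abelian.Ext.contravariant_sequence_exact₁ hex _ y (add_comm 1 i)
      (@Subsingleton.elim _ h _ _)
    change Abelian.Ext.{0} (ModuleCat.of R A) (ModuleCat.of R N) i at z
    refine ⟨z, ?_⟩
    change _ = (Abelian.Ext.mk₀ (x • 𝟙 (ModuleCat.of R A))).comp z _
    rw [Abelian.Ext.mk₀_smul, Abelian.Ext.smul_comp, Abelian.Ext.mk₀_id_comp]
  have hfin : Module.Finite R (Abelian.Ext.{0} (ModuleCat.of R A) (ModuleCat.of R N) i) :=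
    inferInstance
  refine Submodule.subsingleton_iff R |>.1 (subsingleton_of_bot_eq_top (Eq.symm ?_))
  refine Submodule.eq_bot_of_le_smul_of_le_jacobson_bot _ _ hfin.fg_top ?_
    (maximalIdeal_le_jacobson _)
  intro y _
  obtain ⟨z, rfl⟩ := key y
  exact Submodule.smul_mem_smul hx trivial

end ExtVanishing

section Depth

open scoped Pointwise

variable {R : Type} [CommRing R]

theorem ExtVanishes.of_forall_prime [IsNoetherianRing R] {N : Type} [AddCommGroup N] [Module R N]
    (I : Ideal R) {i : ℕ}
    (h : ∀ P : Ideal R, P.IsPrime → I ≤ P → ExtVanishes R (R ⧸ P) N i)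
    {L : Type} [AddCommGroup L] [Module R L] [hL : Module.Finite R L]
    (hI : I ≤ Module.annihilator R L) : ExtVanishes R L N i := by
  induction hL using IsNoetherianRing.induction_on_isQuotientEquivQuotientPrime R with
  | subsingleton L =>
    refine subsingleton_of_forall_eq 0 fun x => ?_
    have : Limits.IsZero (ModuleCat.of R L) := ModuleCat.isZero_of_subsingleton _
    rw [← Abelian.Ext.mk₀_id_comp x, (Limits.IsZero.iff_id_eq_zero _).1 this]
    simp
  | quotient L P e =>
    refine (h P.1 P.2 ?_).congr e.symm (LinearEquiv.refl R N)
    rwa [e.annihilator_eq, Ideal.annihilator_quotient] at hI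
  | exact L₁ L₂ L₃ f g hf hg hfg h₁ h₃ =>
    exact .of_exact_contravariant hf hg hfg (h₁ (hI.trans (f.annihilator_le_of_injective hf)))
      (h₃ (hI.trans (g.annihilator_le_of_surjective hg)))

variable [IsLocalRing R] {N : Type} [AddCommGroup N] [Module R N]

theorem ExtVanishes.quotient_prime [IsNoetherianRing R] [Module.Finite R N] {P : Ideal R}
    (hP : P.IsPrime) (hne : P ≠ maximalIdeal R) {i : ℕ}
    (h : ∀ Q : Ideal R, Q.IsPrime → P < Q → ExtVanishes R (R ⧸ Q) N (i + 1)) :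
    ExtVanishes R (R ⧸ P) N i := by
  obtain ⟨x, hx, hxP⟩ := SetLike.exists_of_lt (lt_of_le_of_ne (le_maximalIdeal hP.ne_top) hne)
  refine .of_isSMulRegular hx ?_ (.of_forall_prime (P ⊔ Ideal.span {x}) (fun Q hQ hPQ => ?_) ?_)
  · rw [isSMulRegular_iff_right_eq_zero_of_smul]
    intro y hy
    obtain ⟨y, rfl⟩ := Ideal.Quotient.mk_surjective y
    rw [← Ideal.Quotient.mk_eq_mk, ← Submodule.Quotient.mk_smul, Ideal.Quotient.mk_eq_mk,
      Ideal.Quotient.eq_zero_iff_mem] at hy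
    exact Ideal.Quotient.eq_zero_iff_mem.2 ((hP.mem_or_mem hy).resolve_left hxP)
  · exact h Q hQ (lt_of_le_of_ne (le_sup_left.trans hPQ) fun hPQ' => hxP
      (hPQ' ▸ hPQ (Ideal.mem_sup_right (Ideal.mem_span_singleton_self x))))
  · refine sup_le ?_ ?_
    · refine le_trans ?_ (LinearMap.annihilator_le_of_surjective
        (Submodule.mkQ (x • (⊤ : Submodule R (R ⧸ P)))) (Submodule.mkQ_surjective _))
      rw [Ideal.annihilator_quotient]
    · rw [Ideal.span_singleton_le_iff_mem, Module.mem_annihilator]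
      intro y
      obtain ⟨y, rfl⟩ := Submodule.mkQ_surjective _ y
      rw [← map_smul, Submodule.mkQ_apply, Submodule.Quotient.mk_eq_zero]
      exact Submodule.smul_mem_pointwise_smul _ _ _ trivial

/-- If `Ext^i(k, N) = 0` for all `i > e`, then `Ext^i(L, N) = 0` for all `i > e` and all finitely
generated `L`. -/
theorem ExtVanishes.of_residueField_of_gt [IsNoetherianRing R] [Module.Finite R N] {e : ℕ}
    (h : ∀ i, e < i → ExtVanishes R (ResidueField R) N i)
    (L : Type) [AddCommGroup L] [Module R L] [Module.Finite R L] {i : ℕ} (hi : e < i) :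
    ExtVanishes R L N i := by
  refine .of_forall_prime ⊥ (fun P hP _ => ?_) bot_le
  induction P using WellFoundedGT.induction generalizing i with
  | ind P ih =>
    rcases eq_or_ne P (maximalIdeal R) with rfl | hne
    · exact h i hi
    · exact .quotient_prime hP hne fun Q hQ hPQ => ih Q hPQ (by omega) hQ bot_le

/-- `N` has depth at least `n`, i.e. `Ext^i(k, N) = 0` for all `i < n`. -/
def DepthGE (R : Type) [CommRing R] [IsLocalRing R] (N : Type) [AddCommGroup N] [Module R N]
    (n : ℕ) : Prop :=
  ∀ i < n, ExtVanishes R (ResidueField R) N i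

theorem DepthGE.congr {N' : Type} [AddCommGroup N'] [Module R N'] (e : N ≃ₗ[R] N') {n : ℕ}
    (h : DepthGE R N n) : DepthGE R N' n :=
  fun i hi => (h i hi).congr (LinearEquiv.refl _ _) e

theorem DepthGE.of_subsingleton [Subsingleton N] (n : ℕ) : DepthGE R N n := by
  refine fun i _ => subsingleton_of_forall_eq 0 fun x => ?_
  have : Limits.IsZero (ModuleCat.of R N) := ModuleCat.isZero_of_subsingleton _
  rw [← x.comp_mk₀_id, (Limits.IsZero.iff_id_eq_zero _).1 this]
  simp

theorem le_rdepth_iff {n : ℕ} : (n : ℕ∞) ≤ rdepth R N ↔ DepthGE R N n := by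
  simp only [rdepth, le_sInf_iff, Set.mem_ofPred_eq, forall_exists_index, and_imp, DepthGE,
    ← subsingleton_extMod_iff]
  constructor
  · intro h i hi
    by_contra hs
    exact absurd (h i i (not_subsingleton_iff_nontrivial.1 hs) rfl) (by simpa using hi)
  · rintro h _ i hi rfl
    by_contra! hlt
    exact not_subsingleton_iff_nontrivial.2 hi (h i (by exact_mod_cast hlt))

omit [IsLocalRing R] in
theorem ringKrullDim_quotient_succ_le_of_lt {P Q : Ideal R} (hP : P.IsPrime) (hPQ : P < Q) :
    ringKrullDim (R ⧸ Q) + 1 ≤ ringKrullDim (R ⧸ P) := by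
  obtain ⟨x, hx, hxP⟩ := SetLike.exists_of_lt hPQ
  exact ringKrullDim_succ_le_of_surjective (Ideal.Quotient.factor hPQ.le)
    (Ideal.Quotient.factor_surjective _)
    (mem_nonZeroDivisors_of_ne_zero (mt Ideal.Quotient.eq_zero_iff_mem.1 hxP))
    (by rwa [Ideal.Quotient.factor_mk, Ideal.Quotient.eq_zero_iff_mem])

theorem DepthGE.extVanishes_quotient_prime [IsNoetherianRing R] [Module.Finite R N] {n : ℕ}
    (h : DepthGE R N n) {P : Ideal R} (hP : P.IsPrime) {d i : ℕ} (hd : ringKrullDim (R ⧸ P) ≤ d)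
    (hi : i + d < n) : ExtVanishes R (R ⧸ P) N i := by
  induction d generalizing P i with
  | zero =>
    rcases eq_or_ne P (maximalIdeal R) with rfl | hne
    · exact h i (by omega)
    · have := (ringKrullDim_quotient_succ_le_of_lt hP
        (lt_of_le_of_ne (le_maximalIdeal hP.ne_top) hne)).trans hd
      have h0 : (0 : WithBot ℕ∞) ≤ ringKrullDim (R ⧸ maximalIdeal R) :=
        ringKrullDim_nonneg_of_nontrivial
      have h1 : (0 : WithBot ℕ∞) + 1 ≤ 0 := le_trans (by gcongr) this
      exact absurd h1 (by decide)
  | succ d ih =>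
    rcases eq_or_ne P (maximalIdeal R) with rfl | hne
    · exact h i (by omega)
    · refine .quotient_prime hP hne fun Q hQ hPQ => ih hQ ?_ (by omega)
      have := (ringKrullDim_quotient_succ_le_of_lt hP hPQ).trans hd
      push_cast at this
      exact ENat.WithBot.add_le_add_one_right_iff.1 this

theorem DepthGE.le_ringKrullDim [IsNoetherianRing R] [Module.Finite R N] {n : ℕ}
    (h : DepthGE R N n) {P : Ideal R} (hP : P ∈ associatedPrimes R N) :
    n ≤ ringKrullDim (R ⧸ P) := by
  by_contra! hlt
  obtain ⟨hP', f, hf⟩ := (isAssociatedPrime_iff_exists_injective_linearMap _ _).1 hP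
  cases n with
  | zero => exact not_lt_of_ge ringKrullDim_nonneg_of_nontrivial hlt
  | succ n =>
    push_cast at hlt
    have := extVanishes_zero_iff.1 (h.extVanishes_quotient_prime hP' (i := 0) (d := n)
      (ENat.WithBot.lt_add_one_iff.1 hlt) (by omega))
    rw [Subsingleton.elim f 0] at hf
    exact one_ne_zero (hf (a₁ := 1) (a₂ := 0) rfl)

theorem depthGE_iff_exists_isWeaklyRegular [IsNoetherianRing R] [Module.Finite R N] {n : ℕ} :
    DepthGE R N n ↔ ∃ rs : List R, rs.length = n ∧ (∀ r ∈ rs, r ∈ maximalIdeal R) ∧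
      RingTheory.Sequence.IsWeaklyRegular N rs := by
  rcases subsingleton_or_nontrivial N with hN | hN
  · exact iff_of_true (.of_subsingleton n) ⟨List.replicate n 0, by simp, by simp,
      ⟨fun _ _ => Function.injective_of_subsingleton _⟩⟩
  · have hlt : maximalIdeal R • (⊤ : Submodule R N) < ⊤ :=
      (Submodule.top_ne_ideal_smul_of_le_jacobson_annihilator
        (maximalIdeal_le_jacobson _)).symm.lt_top
    have hsupp : Module.support R (ResidueField R) =
        PrimeSpectrum.zeroLocus (maximalIdeal R : Set R) := by
      rw [Module.support_eq_zeroLocus]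
      exact congrArg (fun I : Ideal R => PrimeSpectrum.zeroLocus (I : Set R))
        (Ideal.annihilator_quotient)
    constructor
    · intro h
      obtain ⟨rs, hlen, hmem, hreg⟩ := ModuleCat.exists_isRegular_of_exists_subsingleton_ext
        (maximalIdeal R) n (ModuleCat.of R N) hlt (ModuleCat.of R (ResidueField R)) hsupp h
      exact ⟨rs, hlen, hmem, hreg.toIsWeaklyRegular⟩
    · rintro ⟨rs, rfl, hmem, hreg⟩
      exact ModuleCat.subsingleton_ext_of_exists_isRegular (maximalIdeal R)
        (ModuleCat.of R (ResidueField R)) hsupp.subset (ModuleCat.of R N) hlt rs hmem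
        ((IsLocalRing.isRegular_iff_isWeaklyRegular_of_subset_maximalIdeal hmem).2 hreg)

theorem DepthGE.iff_of_surjective [IsNoetherianRing R] [Module.Finite R N]
    {S : Type} [CommRing S] [IsLocalRing S] [Algebra R S]
    (hs : Function.Surjective (algebraMap R S)) [Module S N] [IsScalarTower R S N] {n : ℕ} :
    DepthGE R N n ↔ DepthGE S N n := by
  have : IsNoetherianRing S := isNoetherianRing_of_surjective R S (algebraMap R S) hs
  have : Module.Finite S N := .of_restrictScalars_finite R S N
  have hm : (maximalIdeal S).comap (algebraMap R S) = maximalIdeal R :=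
    eq_maximalIdeal (Ideal.comap_isMaximal_of_surjective _ hs)
  rw [depthGE_iff_exists_isWeaklyRegular, depthGE_iff_exists_isWeaklyRegular]
  constructor
  · rintro ⟨rs, hlen, hmem, hreg⟩
    refine ⟨rs.map (algebraMap R S), by simpa, ?_,
      (RingTheory.Sequence.isWeaklyRegular_map_algebraMap_iff S N rs).2 hreg⟩
    simp only [List.mem_map, forall_exists_index, and_imp, forall_apply_eq_imp_iff₂]
    intro r hr
    rw [← Ideal.mem_comap, hm]
    exact hmem r hr
  · rintro ⟨rs, hlen, hmem, hreg⟩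
    obtain ⟨rs, rfl⟩ := (List.map_surjective_iff.2 hs) rs
    refine ⟨rs, by simpa using hlen, fun r hr => ?_,
      (RingTheory.Sequence.isWeaklyRegular_map_algebraMap_iff S N rs).1 hreg⟩
    rw [← hm]
    exact hmem _ (List.mem_map_of_mem hr)

end Depth

section Linkage

variable {R : Type} [CommRing R] {A B C L N : Type} [AddCommGroup A] [Module R A]
  [AddCommGroup B] [Module R B] [AddCommGroup C] [Module R C] [AddCommGroup L] [Module R L]
  [AddCommGroup N] [Module R N]

theorem ExtVanishes.exists_extension {f : A →ₗ[R] B} {g : B →ₗ[R] C} (hf : Function.Injective f)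
    (hg : Function.Surjective g) (hfg : Function.Exact f g) (hC : ExtVanishes R C N 1)
    (φ : A →ₗ[R] N) : ∃ ψ : B →ₗ[R] N, ψ ∘ₗ f = φ := by
  obtain ⟨y, hy⟩ := Abelian.Ext.contravariant_sequence_exact₁ (shortExact_of_linearMap hf hg hfg)
    _ (Abelian.Ext.mk₀ (ModuleCat.ofHom φ)) (add_zero 1) (@Subsingleton.elim _ hC _ _)
  obtain ⟨y, rfl⟩ := (Abelian.Ext.mk₀_bijective _ _).2 y
  rw [Abelian.Ext.mk₀_comp_mk₀] at hy
  have := (Abelian.Ext.mk₀_bijective _ _).1 hy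
  exact ⟨y.hom, congrArg ModuleCat.Hom.hom this⟩

theorem ExtVanishes.of_projective [Module.Projective R A] {i : ℕ} (hi : 0 < i) :
    ExtVanishes R A N i := by
  obtain ⟨i, rfl⟩ := Nat.exists_eq_succ_of_ne_zero hi.ne'
  have : Projective (ModuleCat.of R A) := (IsProjective.iff_projective A).1 inferInstance
  exact subsingleton_of_forall_eq 0 fun x => x.eq_zero_of_projective

variable [IsLocalRing R]

theorem DepthGE.pi_fin {e : ℕ} (h : DepthGE R N e) (n : ℕ) : DepthGE R (Fin n → N) e :=
  fun i hi => (h i hi).pi_fin n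

theorem DepthGE.dual_pi_fin {e : ℕ} (h : DepthGE R R e) (n : ℕ) :
    DepthGE R (Module.Dual R (Fin n → R)) e :=
  (h.pi_fin n).congr (Pi.basisFun R (Fin n)).toDualEquiv

variable [IsNoetherianRing R]

theorem DepthGE.extVanishes_of_pos [Module.Finite R L] [Module.Finite R N] {e : ℕ}
    (hN : ∀ i, e < i → ExtVanishes R (ResidueField R) N i) (h : DepthGE R L e) {i : ℕ}
    (hi : 0 < i) : ExtVanishes R L N i := by
  obtain ⟨rs, hlen, hmem, hreg⟩ := depthGE_iff_exists_isWeaklyRegular.1 h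
  replace hi : e < i + rs.length := by omega
  clear h hlen
  induction rs generalizing L i with
  | nil => exact .of_residueField_of_gt hN L hi
  | cons x rs ih =>
    obtain ⟨hx, hrs⟩ := (RingTheory.Sequence.isWeaklyRegular_cons_iff _ _ _).1 hreg
    exact .of_isSMulRegular (hmem x List.mem_cons_self) hx
      (ih (fun r hr => hmem r (List.mem_cons_of_mem _ hr)) hrs
        (by rw [List.length_cons] at hi; omega))

theorem DepthGE.dual {e : ℕ} (hR : DepthGE R R e) [Module.Finite R L]
    (h : ∀ i, 0 < i → ExtVanishes R L R i) : DepthGE R (Module.Dual R L) e := by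
  intro i
  induction i generalizing L with
  | zero =>
    intro hi
    obtain ⟨n, g, hg⟩ := Module.Finite.exists_fin' R L
    have := extVanishes_zero_iff.1 (hR.dual_pi_fin n 0 hi)
    refine extVanishes_zero_iff.2 ⟨fun a b => LinearMap.ext fun x => ?_⟩
    exact LinearMap.dualMap_injective_of_surjective hg
      (LinearMap.congr_fun (Subsingleton.elim (g.dualMap ∘ₗ a) (g.dualMap ∘ₗ b)) x)
  | succ i ih =>
    intro hi
    obtain ⟨n, g, hg⟩ := Module.Finite.exists_fin' R L
    have hex : Function.Exact (LinearMap.ker g).subtype g := g.exact_subtype_ker_map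
    refine .covariant_left_of_exact (f := g.dualMap) (g := (LinearMap.ker g).subtype.dualMap)
      (LinearMap.dualMap_injective_of_surjective hg) ?_ ?_ (ih (fun j hj => ?_) (by omega))
      (hR.dual_pi_fin n _ hi)
    · exact (h 1 one_pos).exists_extension Subtype.val_injective hg hex
    · rw [LinearMap.exact_iff, LinearMap.ker_dualMap_eq_dualAnnihilator_range,
        Submodule.range_subtype, LinearMap.range_dualMap_eq_dualAnnihilator_ker_of_surjective g hg]
    · exact .left_of_exact Subtype.val_injective hg hex (.of_projective hj) (h _ j.succ_pos)

theorem horizontallyLinked.depthGE {M : Type} [AddCommGroup M] [Module R M] [Module.Finite R M]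
    {e : ℕ} (hR : DepthGE R R e) (hR' : ∀ i, e < i → ExtVanishes R (ResidueField R) R i)
    (hl : horizontallyLinked R M N) (hM : DepthGE R M e) : DepthGE R N e := by
  obtain ⟨-, n₀, n₁, f, g, hg, hfg, ⟨E⟩⟩ := hl
  have h (i : ℕ) (hi : 0 < i) : ExtVanishes R M R i := hM.extVanishes_of_pos hR' hi
  have hex : Function.Exact (LinearMap.range f).subtype g := by
    rw [LinearMap.exact_iff, Submodule.range_subtype, hfg]
  have hsurj : Function.Surjective (LinearMap.range f).subtype.dualMap :=
    (h 1 one_pos).exists_extension Subtype.val_injective hg hex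
  have hrange : LinearMap.range f.dualMap = LinearMap.range f.rangeRestrict.dualMap := by
    have : f.dualMap = f.rangeRestrict.dualMap ∘ₗ (LinearMap.range f).subtype.dualMap := rfl
    rw [this, LinearMap.range_comp_of_range_eq_top _ (LinearMap.range_eq_top.2 hsurj)]
  refine (hR.dual (L := LinearMap.range f) fun i hi => ?_).congr
    (LinearEquiv.ofInjective f.rangeRestrict.dualMap
      (LinearMap.dualMap_injective_of_surjective f.surjective_rangeRestrict) ≪≫ₗ
      LinearEquiv.ofEq _ _ hrange.symm ≪≫ₗ E.symm)
  exact .left_of_exact Subtype.val_injective hg hex (.of_projective hi) (h _ i.succ_pos)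

omit [IsLocalRing R] [IsNoetherianRing R] in
theorem horizontallyLinked.exists_injective (hl : horizontallyLinked R A B) :
    ∃ (n : ℕ) (f : A →ₗ[R] (Fin n → R)), Function.Injective f := by
  obtain ⟨⟨n₀, n₁, f, -, -, -, ⟨E⟩⟩, -⟩ := hl
  exact ⟨n₁, (Pi.basisFun R (Fin n₁)).toDualEquiv.symm.toLinearMap ∘ₗ
    (LinearMap.range f.dualMap).subtype ∘ₗ E.toLinearMap,
    (Pi.basisFun R (Fin n₁)).toDualEquiv.symm.injective.comp
      (Subtype.val_injective.comp E.injective)⟩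

end Linkage

section SequentiallyCohenMacaulay

variable {R : Type} [CommRing R] {N : Type} [AddCommGroup N] [Module R N]

theorem mdim_congr {N' : Type} [AddCommGroup N'] [Module R N'] (E : N ≃ₗ[R] N') :
    mdim R N = mdim R N' := by
  rw [mdim, mdim, E.annihilator_eq]

theorem mdim_le_ringKrullDim {S : Type} [CommRing S] [Algebra R S]
    (hs : Function.Surjective (algebraMap R S))
    (hN : RingHom.ker (algebraMap R S) ≤ Module.annihilator R N) :
    mdim R N ≤ ringKrullDim S := by
  rw [mdim, ← ringKrullDim_eq_of_ringEquiv (RingHom.quotientKerEquivOfSurjective hs)]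
  exact ringKrullDim_le_of_surjective (Ideal.Quotient.factor hN)
    (Ideal.Quotient.factor_surjective _)

variable [IsNoetherianRing R] [IsLocalRing R]

omit [IsNoetherianRing R] [IsLocalRing R] in
theorem ringKrullDim_quotient_le_mdim {P : Ideal R} (hP : P ∈ associatedPrimes R N) :
    ringKrullDim (R ⧸ P) ≤ mdim R N := by
  have h : Module.annihilator R N ≤ P :=
    Submodule.annihilator_top (R := R) (M := N) ▸ IsAssociatedPrime.annihilator_le hP
  exact ringKrullDim_le_of_surjective (Ideal.Quotient.factor h) (Ideal.Quotient.factor_surjective h)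

theorem DepthGE.le_mdim [Module.Finite R N] [Nontrivial N] {e : ℕ} (h : DepthGE R N e) :
    e ≤ mdim R N := by
  obtain ⟨P, hP⟩ := associatedPrimes.nonempty R N
  exact (h.le_ringKrullDim hP).trans (ringKrullDim_quotient_le_mdim hP)

theorem isCM_of_depthGE [Module.Finite R N] [Nontrivial N] {e : ℕ} (h : DepthGE R N e)
    (hdim : mdim R N = e) : isCM R N := by
  have : rdepth R N = e := by
    refine le_antisymm ?_ (le_rdepth_iff.2 h)
    by_contra! hlt
    have h' : DepthGE R N (e + 1) := le_rdepth_iff.1 (by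
      push_cast
      exact Order.add_one_le_of_lt hlt)
    have := h'.le_mdim
    rw [hdim] at this
    norm_cast at this
    omega
  rw [isCM, this, hdim]
  rfl

variable {S : Type} [CommRing S] [IsLocalRing S] [Algebra R S] {e n : ℕ}

omit [IsNoetherianRing R] [IsLocalRing R] [IsLocalRing S] in
theorem ker_algebraMap_le_annihilator {f : N →ₗ[R] (Fin n → S)} (hf : Function.Injective f) :
    RingHom.ker (algebraMap R S) ≤ Module.annihilator R N := by
  intro a ha
  rw [Module.mem_annihilator]
  intro x
  apply hf
  ext j
  simp [Algebra.smul_def, (RingHom.mem_ker).1 ha]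

theorem mdim_eq_of_injective [Nontrivial N] (hs : Function.Surjective (algebraMap R S))
    (hS : DepthGE S S e) (hdim : ringKrullDim S = e) {f : N →ₗ[R] (Fin n → S)}
    (hf : Function.Injective f) : mdim R N = e := by
  have : Module.Finite R S := .of_surjective (Algebra.linearMap R S) hs
  refine le_antisymm (hdim ▸ mdim_le_ringKrullDim hs (ker_algebraMap_le_annihilator hf)) ?_
  obtain ⟨P, hP⟩ := associatedPrimes.nonempty R N
  exact (((DepthGE.iff_of_surjective hs).2 (hS.pi_fin n)).le_ringKrullDim
    (associatedPrimes.subset_of_injective hf hP)).trans (ringKrullDim_quotient_le_mdim hP)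

/-- The subquotient `B ⧸ A` of `N` is `B` if `A = ⊥`. -/
noncomputable def subquotientEquiv {A : Submodule R N} (B : Submodule R N) (hA : A = ⊥) :
    (↥B ⧸ A.comap B.subtype) ≃ₗ[R] B :=
  Submodule.quotEquivOfEqBot _ (by rw [hA]; exact LinearMap.ker_eq_bot.2 Subtype.val_injective)

theorem isSeqCM.depthGE (hs : Function.Surjective (algebraMap R S)) (hS : DepthGE S S e)
    (hdim : ringKrullDim S = e) {f : N →ₗ[R] (Fin n → S)} (hf : Function.Injective f)
    (h : isSeqCM R N) : DepthGE R N e := by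
  rcases subsingleton_or_nontrivial N with hN | hN
  · exact .of_subsingleton e
  obtain ⟨r, Φ, h0, h1, hmono, hCM, hlt⟩ := h
  match r, Φ, h0, h1, hmono, hCM, hlt with
  | 0, Φ, h0, h1, _, _, _ => exact absurd (h0.symm.trans h1) bot_ne_top
  | 1, Φ, h0, h1, _, hCM, _ =>
    have E := subquotientEquiv (Φ (Fin.succ 0)) (A := Φ (Fin.castSucc 0)) h0 ≪≫ₗ
      LinearEquiv.ofTop _ h1
    have := hCM 0
    rw [isCM, mdim_congr E, mdim_eq_of_injective hs hS hdim hf] at this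
    refine (le_rdepth_iff.1 (WithBot.coe_le_coe.1 (le_of_eq ?_))).congr E
    exact this.symm
  | r + 2, Φ, h0, h1, hmono, _, hlt =>
    refine absurd (hlt 0 1 (by simp)) (not_lt_of_ge ?_)
    have hne : Φ (Fin.succ 0) ≠ ⊥ := h0 ▸ (hmono (Fin.succ_pos 0)).ne'
    have := Submodule.nontrivial_iff_ne_bot.2 hne
    have E := subquotientEquiv (Φ (Fin.succ 0)) (A := Φ (Fin.castSucc 0)) h0
    rw [mdim_congr E, mdim_eq_of_injective hs hS hdim (f := f ∘ₗ Submodule.subtype _)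
      (hf.comp Subtype.val_injective), ← hdim]
    refine mdim_le_ringKrullDim hs ((ker_algebraMap_le_annihilator hf).trans ?_)
    exact (LinearMap.annihilator_le_of_injective (Submodule.subtype _) Subtype.val_injective).trans
      (LinearMap.annihilator_le_of_surjective (Submodule.mkQ _) (Submodule.mkQ_surjective _))

theorem isSeqCM_of_depthGE [Module.Finite R N] (h : DepthGE R N e)
    (hdim : Nontrivial N → mdim R N = e) : isSeqCM R N := by
  rcases subsingleton_or_nontrivial N with hN | hN
  · exact ⟨0, fun _ => ⊥, rfl, Subsingleton.elim _ _,
      fun i j hij => absurd hij (by simp [Fin.fin_one_eq_zero]), fun i => i.elim0, fun i => i.elim0⟩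
  have E := subquotientEquiv (⊤ : Submodule R N) (rfl : ⊥ = ⊥) ≪≫ₗ Submodule.topEquiv
  have := E.symm.injective.nontrivial
  have hCM := isCM_of_depthGE (h.congr E.symm) ((mdim_congr E).trans (hdim hN))
  refine ⟨1, ![⊥, ⊤], rfl, rfl, ?_, ?_, ?_⟩
  · rw [Fin.strictMono_iff_lt_succ]
    intro i
    fin_cases i
    exact bot_lt_top
  · intro i
    fin_cases i
    exact hCM
  · intro i j hij
    exact absurd hij (by simp [Subsingleton.elim i j])

end SequentiallyCohenMacaulay

theorem linkedByIdeal.exists_injective {R : Type} [CommRing R] {𝔠 : Ideal R} {A B : Type}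
    [AddCommGroup A] [Module R A] [AddCommGroup B] [Module R B] (h : linkedByIdeal R 𝔠 A B) :
    ∃ (n : ℕ) (f : A →ₗ[R] (Fin n → R ⧸ 𝔠)), Function.Injective f := by
  obtain ⟨h₁, h₂, h⟩ := h
  let := h₁.module
  have := h₁.isScalarTower (S := R)
  let := h₂.module
  obtain ⟨n, f, hf⟩ := h.exists_injective
  exact ⟨n, f.restrictScalars R, hf⟩

theorem linkedByIdeal.symm {R : Type} [CommRing R] {𝔠 : Ideal R} {A B : Type}
    [AddCommGroup A] [Module R A] [AddCommGroup B] [Module R B] (h : linkedByIdeal R 𝔠 A B) :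
    linkedByIdeal R 𝔠 B A := by
  obtain ⟨h₁, h₂, h⟩ := h
  exact ⟨h₂, h₁, And.symm h⟩

theorem linkedByIdeal.depthGE {R : Type} [CommRing R] [IsNoetherianRing R] [IsLocalRing R]
    {𝔠 : Ideal R} [IsLocalRing (R ⧸ 𝔠)] {e : ℕ} (h𝔠 : DepthGE (R ⧸ 𝔠) (R ⧸ 𝔠) e)
    (h𝔠' : ∀ i, e < i → ExtVanishes (R ⧸ 𝔠) (ResidueField (R ⧸ 𝔠)) (R ⧸ 𝔠) i) {A B : Type}
    [AddCommGroup A] [Module R A] [Module.Finite R A] [AddCommGroup B] [Module R B]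
    [Module.Finite R B] (h : linkedByIdeal R 𝔠 A B) (hA : DepthGE R A e) : DepthGE R B e := by
  obtain ⟨h₁, h₂, h⟩ := h
  let := h₁.module
  let := h₂.module
  have := h₁.isScalarTower (S := R)
  have := h₂.isScalarTower (S := R)
  have : Module.Finite (R ⧸ 𝔠) A := .of_restrictScalars_finite R _ A
  have hs : Function.Surjective (algebraMap R (R ⧸ 𝔠)) := Ideal.Quotient.mk_surjective
  exact (DepthGE.iff_of_surjective hs).2
    (h.depthGE h𝔠 h𝔠' ((DepthGE.iff_of_surjective hs).1 hA))

theorem isGorensteinLocalRing.exists_depthGE {S : Type} [CommRing S] [IsLocalRing S]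
    (h : isGorensteinLocalRing S) : ∃ e : ℕ, ringKrullDim S = e ∧ DepthGE S S e ∧
      ∀ i, e < i → ExtVanishes S (ResidueField S) S i := by
  obtain ⟨e, hdim, -, hext, -⟩ := h
  exact ⟨e, hdim, fun i hi => (subsingleton_extMod_iff i).1 (hext i hi.ne),
    fun i hi => (subsingleton_extMod_iff i).1 (hext i hi.ne')⟩

/-- Over a Gorenstein Noetherian local ring `R`, let `𝔠₁, 𝔠₂` be ideals of the
same height `g` with Gorenstein quotients, and suppose `M₁` is linked to `M` by `𝔠₁` and `M` is
linked to `M₂` by `𝔠₂`. If `M₁` is sequentially Cohen-Macaulay then so is `M₂`. -/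
theorem statement5 (R : Type) [CommRing R] [IsNoetherianRing R] [IsLocalRing R]
    (hGor : isGorensteinLocalRing R)
    (𝔠₁ 𝔠₂ : Ideal R) [IsLocalRing (R ⧸ 𝔠₁)] [IsLocalRing (R ⧸ 𝔠₂)]
    (g : ℕ) (hht₁ : idealHeight R 𝔠₁ = g) (hht₂ : idealHeight R 𝔠₂ = g)
    (hGor₁ : isGorensteinLocalRing (R ⧸ 𝔠₁)) (hGor₂ : isGorensteinLocalRing (R ⧸ 𝔠₂))
    (M₁ M M₂ : Type) [AddCommGroup M₁] [Module R M₁] [Module.Finite R M₁]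
    [AddCommGroup M] [Module R M] [Module.Finite R M]
    [AddCommGroup M₂] [Module R M₂] [Module.Finite R M₂]
    (hl₁ : linkedByIdeal R 𝔠₁ M₁ M) (hl₂ : linkedByIdeal R 𝔠₂ M M₂)
    (hseq : isSeqCM R M₁) : isSeqCM R M₂ := by
  obtain ⟨e₁, hdim₁, hS₁, hS₁'⟩ := hGor₁.exists_depthGE
  obtain ⟨e₂, hdim₂, hS₂, hS₂'⟩ := hGor₂.exists_depthGE
  have hs₁ : Function.Surjective (algebraMap R (R ⧸ 𝔠₁)) := Ideal.Quotient.mk_surjective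
  have hs₂ : Function.Surjective (algebraMap R (R ⧸ 𝔠₂)) := Ideal.Quotient.mk_surjective
  obtain ⟨_, f₁, hf₁⟩ := hl₁.exists_injective
  obtain ⟨_, f₂, hf₂⟩ := hl₂.symm.exists_injective
  have hM : DepthGE R M e₁ := hl₁.depthGE hS₁ hS₁' (hseq.depthGE hs₁ hS₁ hdim₁ hf₁)
  have hM' : DepthGE R M e₂ := by
    rcases subsingleton_or_nontrivial M with _ | _
    · exact .of_subsingleton e₂
    · obtain ⟨_, g₁, hg₁⟩ := hl₁.symm.exists_injective
      obtain ⟨_, g₂, hg₂⟩ := hl₂.exists_injective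
      have h := (mdim_eq_of_injective hs₁ hS₁ hdim₁ hg₁).symm.trans
        (mdim_eq_of_injective hs₂ hS₂ hdim₂ hg₂)
      have h' : e₁ = e₂ := by exact_mod_cast h
      exact h' ▸ hM
  exact isSeqCM_of_depthGE (hl₂.depthGE hS₂ hS₂' hM')
    fun _ => mdim_eq_of_injective hs₂ hS₂ hdim₂ hf₂
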